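/- arXiv:1803.08301 — 2 statements merged into one kernel-verified Lean document; each statement's English description precedes it below -/
import Mathlib

section
/- Let n ≥ 2 and let {H_iα_i}_{i=1}^{s} be a coset partition of the free group F_n, where H_i < F_n has finite index d_i, α_i ∈ F_n, and 1 < d_1 ≤ … ≤ d_s. If the transition group T_s of H_s contains a d_s-cycle (i.e., some element of F_n acts on the d_s right cosets of H_s as a single cycle of length d_s), then the index d_s appears in the partition at least p times, where p is the smallest prime dividing d_s; moreover any two subgroups H_i and H_j of the partition with d_i = d_j are isomorphic as groups. -/
/-- The `A`-valued cocycles of the left translation action of `G` on `G ⧸ H`. -/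
def CosetCocycle {G : Type*} [Group G] (H : Subgroup G) (A : Type*) [CommGroup A] : Type _ :=
  {c : G → G ⧸ H → A // ∀ g h q, c (g * h) q = c g q * c h (g⁻¹ • q)}

namespace CosetCocycle

section Basic

variable {G : Type*} [Group G] {H : Subgroup G} {A : Type*} [CommGroup A]

theorem inv_smul_coe_one_of_mem {h : G} (hh : h ∈ H) :
    h⁻¹ • ((1 : G) : G ⧸ H) = ((1 : G) : G ⧸ H) := by
  rw [MulAction.Quotient.smul_coe, QuotientGroup.eq]
  simpa using hh

theorem inv_out_smul (q : G ⧸ H) : q.out⁻¹ • q = ((1 : G) : G ⧸ H) := by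
  rw [inv_smul_eq_iff, MulAction.Quotient.smul_coe]
  simp

theorem out_one_mem : ((1 : G) : G ⧸ H).out ∈ H := by
  have : ((1 : G) : G ⧸ H) = ((((1 : G) : G ⧸ H).out : G) : G ⧸ H) := by simp
  simpa using QuotientGroup.eq.1 this

/-- A cocycle restricts to a homomorphism on the stabilizer of the base point. -/
def restrict (c : CosetCocycle H A) : H →* A :=
  MonoidHom.mk' (fun h => c.1 h ((1 : G) : G ⧸ H)) fun a b => by
    rw [Subgroup.coe_mul, c.2, inv_smul_coe_one_of_mem a.2]

theorem transport_mem (g : G) (q : G ⧸ H) : q.out⁻¹ * g * (g⁻¹ • q).out ∈ H := by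
  rw [mul_assoc, ← QuotientGroup.eq, ← smul_eq_mul, ← MulAction.Quotient.smul_coe]
  simp

/-- The cocycle induced from a homomorphism on `H`, twisted by the coboundary of `t`. -/
noncomputable def induce (φ : H →* A) (t : G ⧸ H → A) : CosetCocycle H A :=
  ⟨fun g q => t q * φ ⟨_, transport_mem g q⟩ * (t (g⁻¹ • q))⁻¹, fun g h q => by
    have key : (⟨_, transport_mem (g * h) q⟩ : H) =
        ⟨_, transport_mem g q⟩ * ⟨_, transport_mem h (g⁻¹ • q)⟩ := by
      ext
      simp [mul_assoc, mul_smul]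
    have hsmul : (g * h)⁻¹ • q = h⁻¹ • g⁻¹ • q := by rw [mul_inv_rev, mul_smul]
    beta_reduce
    rw [key, map_mul, hsmul]
    group⟩

/-- A cocycle together with a constant amounts to a homomorphism on `H` together with a function
on the cosets. -/
noncomputable def prodEquiv : CosetCocycle H A × A ≃ (H →* A) × (G ⧸ H → A) where
  toFun x := (restrict x.1, fun q => x.1.1 q.out q * x.2)
  invFun y := (induce y.1 y.2, y.2 ((1 : G) : G ⧸ H) * (y.1 ⟨_, out_one_mem⟩)⁻¹)
  left_inv x := by
    obtain ⟨c, a⟩ := x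
    refine Prod.ext (Subtype.ext (funext₂ fun g q => ?_)) ?_
    · change c.1 q.out q * a * c.1 (q.out⁻¹ * g * (g⁻¹ • q).out) ((1 : G) : G ⧸ H) *
        (c.1 (g⁻¹ • q).out (g⁻¹ • q) * a)⁻¹ = c.1 g q
      have h₁ := c.2 g (g⁻¹ • q).out q
      have h₂ := c.2 q.out (q.out⁻¹ * g * (g⁻¹ • q).out) q
      rw [inv_out_smul, mul_assoc q.out⁻¹, mul_inv_cancel_left, h₁] at h₂
      rw [mul_inv_eq_iff_eq_mul, mul_assoc q.out⁻¹, mul_right_comm, ← h₂, mul_assoc]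
    · change c.1 _ _ * a * (c.1 _ _)⁻¹ = a
      simp
  right_inv y := by
    obtain ⟨φ, t⟩ := y
    refine Prod.ext (MonoidHom.ext fun h => ?_) (funext fun q => ?_)
    · change t _ * φ ⟨_, transport_mem (h : G) ((1 : G) : G ⧸ H)⟩ * (t _)⁻¹ = φ h
      have key : (⟨_, transport_mem (h : G) ((1 : G) : G ⧸ H)⟩ : H) =
          ⟨_, out_one_mem⟩⁻¹ * h * ⟨_, out_one_mem⟩ := by
        ext
        simp [inv_smul_coe_one_of_mem h.2]
      rw [key, inv_smul_coe_one_of_mem h.2]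
      simp
    · change t q * φ ⟨_, transport_mem q.out q⟩ * (t (q.out⁻¹ • q))⁻¹ * (t _ * (φ _)⁻¹) = t q
      have key : (⟨_, transport_mem q.out q⟩ : H) = ⟨_, out_one_mem⟩ := by
        ext
        simp [inv_out_smul]
      rw [key, inv_out_smul]
      simp

/-- The section of the semidirect product attached to a cocycle. -/
def toHom (c : CosetCocycle H A) :
    G →* (G ⧸ H → A) ⋊[mulAutArrow] G :=
  MonoidHom.mk' (fun g => ⟨c.1 g, g⟩) fun g h => SemidirectProduct.ext (funext (c.2 g h)) rfl

end Basic

section FreeGroup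

variable {ι : Type*} {H : Subgroup (FreeGroup ι)} {A : Type*} [CommGroup A]

/-- A cocycle of a free group is determined by arbitrary values on the generators. -/
theorem bijective_of :
    Function.Bijective fun (c : CosetCocycle H A) i => c.1 (FreeGroup.of i) := by
  refine ⟨fun c c' h => ?_, fun u => ?_⟩
  · have : toHom c = toHom c' :=
      FreeGroup.ext_hom _ _ fun i => SemidirectProduct.ext (congrFun h i) rfl
    exact Subtype.ext (funext fun g => congrArg SemidirectProduct.left (DFunLike.congr_fun this g))
  · let f : FreeGroup ι →* (FreeGroup ι ⧸ H → A) ⋊[mulAutArrow] FreeGroup ι :=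
      FreeGroup.lift fun i => ⟨u i, FreeGroup.of i⟩
    have hf : ∀ g, (f g).right = g := by
      have : SemidirectProduct.rightHom.comp f = MonoidHom.id _ :=
        FreeGroup.ext_hom _ _ fun i => by simp [f]
      exact DFunLike.congr_fun this
    refine ⟨⟨fun g => (f g).left, fun g h q => ?_⟩, funext fun i => by simp [f]⟩
    beta_reduce
    rw [map_mul, SemidirectProduct.mul_left, hf]
    rfl

end FreeGroup

end CosetCocycle

/-- The number of homomorphisms from a finite index subgroup of a free group to an abelian group
depends only on the index. -/
theorem Subgroup.card_hom_mul_card_pow_index {ι : Type*} [Finite ι] (H : Subgroup (FreeGroup ι))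
    [H.FiniteIndex] (A : Type*) [CommGroup A] :
    Nat.card (H →* A) * Nat.card A ^ H.index =
      (Nat.card A ^ H.index) ^ Nat.card ι * Nat.card A := by
  have h₁ := Nat.card_congr (CosetCocycle.prodEquiv (H := H) (A := A))
  have h₂ := Nat.card_congr (Equiv.ofBijective _ (CosetCocycle.bijective_of (H := H) (A := A)))
  rw [Nat.card_prod, Nat.card_prod, h₂, Nat.card_fun, Nat.card_fun] at h₁
  exact h₁.symm

/-- Subgroups of the same finite index in a finitely generated free group are isomorphic. -/
theorem Subgroup.nonempty_mulEquiv_of_index_eq {ι : Type*} [Finite ι] {H K : Subgroup (FreeGroup ι)}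
    [H.FiniteIndex] (h : H.index = K.index) : Nonempty (H ≃* K) := by
  have : K.FiniteIndex := ⟨h ▸ Subgroup.FiniteIndex.index_ne_zero⟩
  let A := Multiplicative (ZMod 2)
  have hA : Nat.card A = 2 := Nat.card_zmod 2
  have card_eq : Nat.card (H →* A) = Nat.card (K →* A) := by
    have h₁ := H.card_hom_mul_card_pow_index A
    rw [h, ← K.card_hom_mul_card_pow_index A, hA] at h₁
    exact Nat.eq_of_mul_eq_mul_right (by positivity) h₁
  have finite (L : Subgroup (FreeGroup ι)) [L.FiniteIndex] :
      Finite (IsFreeGroup.Generators L) := by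
    have h₁ := L.card_hom_mul_card_pow_index A
    rw [← Nat.card_congr (IsFreeGroup.lift (G := L) (H := A)), hA] at h₁
    by_contra hinf
    rw [not_finite_iff_infinite] at hinf
    have : Nat.card (IsFreeGroup.Generators L → A) = 0 := Nat.card_eq_zero_of_infinite
    rw [this, zero_mul] at h₁
    exact absurd h₁.symm (by positivity)
  have := finite H
  have := finite K
  rw [← Nat.card_congr (IsFreeGroup.lift (G := H) (H := A)),
    ← Nat.card_congr (IsFreeGroup.lift (G := K) (H := A)), Nat.card_fun, Nat.card_fun, hA] at card_eq
  obtain ⟨f⟩ := Finite.card_eq.1 (Nat.pow_right_injective le_rfl card_eq)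
  exact ⟨(IsFreeGroup.toFreeGroup H).trans
    ((FreeGroup.freeGroupCongr f).trans (IsFreeGroup.toFreeGroup K).symm)⟩

theorem Function.Periodic.sum_range_add {M : Type*} [AddCommGroup M] {f : ℕ → M} {N : ℕ}
    (hf : Function.Periodic f N) (e : ℕ) :
    ∑ k ∈ Finset.range N, f (k + e) = ∑ k ∈ Finset.range N, f k := by
  induction e with
  | zero => rfl
  | succ e ih =>
    rw [← ih]
    have h₁ := Finset.sum_range_succ (fun k => f (k + e)) N
    have h₂ := Finset.sum_range_succ' (fun k => f (k + e)) N
    have h₃ : f (N + e) = f (0 + e) := by rw [add_comm, hf, zero_add]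
    rw [h₁, h₃] at h₂
    simpa [add_right_comm, add_assoc, add_comm 1 e] using (add_right_cancel h₂).symm

/-- The exponential sum of a residue class modulo `e` vanishes at `z` unless `z ^ e = 1`. -/
theorem sum_ite_pow_eq_zero {K : ℕ → Prop} [DecidablePred K] {e N : ℕ} {z : ℂ}
    (hK : ∀ k, K (k + e) ↔ K k) (he : e ∣ N) (hN : z ^ N = 1) (hz : z ^ e ≠ 1) :
    ∑ k ∈ Finset.range N, (if K k then z ^ k else 0) = 0 := by
  have hKN : ∀ k, K (k + N) ↔ K k := by
    obtain ⟨c, rfl⟩ := he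
    have hper : Function.Periodic K e := fun k => propext (hK k)
    intro k
    rw [mul_comm]
    exact iff_of_eq (hper.nat_mul c k)
  have hper : Function.Periodic (fun k => if K k then z ^ k else 0) N := fun k => by
    simp only [hKN, pow_add, hN, mul_one]
  have h := hper.sum_range_add e
  simp only [hK, pow_add, mul_comm _ (z ^ e), ← mul_ite_zero, ← Finset.mul_sum] at h
  by_contra hne
  exact hz ((mul_eq_right₀ hne).1 h)

/-- Newman's theorem: in a partition of `ℕ` into residue classes (some possibly empty) whose largest
modulus `m > 1` occurs for a nonempty class, that modulus occurs at least as often as the smallest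
prime factor of `m`. -/
theorem minFac_le_card_of_residue_partition {ι : Type*} [Fintype ι] (K : ι → ℕ → Prop)
    (e : ι → ℕ) {m : ℕ} (hm : 1 < m) (he : ∀ i, 0 < e i) (hem : ∀ i, e i ≤ m)
    (hK : ∀ i k l, K i k → (K i l ↔ k ≡ l [MOD e i]))
    (hpart : ∀ k, ∃! i, K i k) {i₀ : ι} (hi₀ : e i₀ = m) (hne : ∃ k, K i₀ k) :
    m.minFac ≤ (Finset.univ.filter fun i => e i = m).card := by
  classical
  by_contra! hlt
  have hm0 : m ≠ 0 := by omega
  obtain ⟨ζ, hζ⟩ : ∃ ζ : ℂ, IsPrimitiveRoot ζ m := ⟨_, Complex.isPrimitiveRoot_exp m hm0⟩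
  set B := Finset.univ.filter fun i => e i = m with hB
  set N := m.factorial with hN
  have hmN : m ∣ N := Nat.dvd_factorial (by omega) le_rfl
  have hshift : ∀ i k, K i (k + e i) ↔ K i k := fun i k =>
    ⟨fun h => (hK i _ _ h).2 (by simp [Nat.ModEq]), fun h => (hK i _ _ h).2 (by simp [Nat.ModEq])⟩
  have hsplit : ∀ k (c : ℂ), ∑ i, (if K i k then c else 0) = c := by
    intro k c
    obtain ⟨i, hi, hu⟩ := hpart k
    rw [Finset.sum_eq_single i (fun j _ hj => if_neg fun h => hj (hu j h))
      (fun h => absurd (Finset.mem_univ i) h), if_pos hi]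
  -- only the classes of largest modulus contribute at a primitive root
  have hprim : ∀ z : ℂ, IsPrimitiveRoot z m →
      ∑ i ∈ B, ∑ k ∈ Finset.range N, (if K i k then z ^ k else 0) = 0 := by
    intro z hz
    have hzN : z ^ N = 1 := (hz.pow_eq_one_iff_dvd N).2 hmN
    have htotal : ∑ i, ∑ k ∈ Finset.range N, (if K i k then z ^ k else 0) = 0 := by
      rw [Finset.sum_comm]
      simp only [hsplit]
      have := mul_geom_sum z N
      rw [hzN, sub_self] at this
      exact (mul_eq_zero.1 this).resolve_left (sub_ne_zero.2 (hz.ne_one hm))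
    refine (Finset.sum_subset (Finset.subset_univ B) fun i _ hi => ?_).trans htotal
    have hlt' : e i < m := lt_of_le_of_ne (hem i) (by simpa [hB] using hi)
    exact sum_ite_pow_eq_zero (hshift i) (Nat.dvd_factorial (he i) (hem i)) hzN
      (hz.pow_ne_one_of_pos_of_lt (he i).ne' hlt')
  have hpow : ∀ j, 0 < j → j < m.minFac →
      ∑ i ∈ B, ∑ k ∈ Finset.range N, (if K i k then (ζ ^ k) ^ j else 0) = 0 := by
    intro j hj hjm
    have := hprim (ζ ^ j) (hζ.pow_of_coprime j (Nat.coprime_of_lt_minFac hj.ne' hjm).symm)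
    simpa only [← pow_mul, mul_comm j] using this
  have hpoly : ∀ Q : Polynomial ℂ, Q.coeff 0 = 0 → Q.natDegree < m.minFac →
      ∑ i ∈ B, ∑ k ∈ Finset.range N, (if K i k then Q.eval (ζ ^ k) else 0) = 0 := by
    intro Q hQ0 hQd
    have : ∀ i k, (if K i k then Q.eval (ζ ^ k) else 0) =
        ∑ j ∈ Finset.range (Q.natDegree + 1), Q.coeff j * (if K i k then (ζ ^ k) ^ j else 0) := by
      intro i k
      split_ifs <;> simp [Polynomial.eval_eq_sum_range]
    simp only [this]
    rw [Finset.sum_congr rfl fun i _ => Finset.sum_comm, Finset.sum_comm]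
    simp only [← Finset.mul_sum]
    refine Finset.sum_eq_zero fun j hj => ?_
    rcases Nat.eq_zero_or_pos j with rfl | hj0
    · rw [hQ0, zero_mul]
    · rw [hpow j hj0 (by have := Finset.mem_range.1 hj; omega), mul_zero]
  have hres : ∀ i ∈ B, ∃ x : ℂ, ∀ k, K i k → ζ ^ k = x := by
    intro i hi
    by_cases h : ∃ k, K i k
    · obtain ⟨k, hk⟩ := h
      refine ⟨ζ ^ k, fun l hl => ?_⟩
      have := (hK i l k hl).1 hk
      rw [(Finset.mem_filter.1 hi).2] at this
      rw [← pow_mod_orderOf, ← pow_mod_orderOf ζ k, ← hζ.eq_orderOf, this]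
    · exact ⟨0, fun k hk => (h ⟨k, hk⟩).elim⟩
  choose! x hx using hres
  have hi₀B : i₀ ∈ B := by simp [hB, hi₀]
  obtain ⟨k₀, hk₀, hk₀N⟩ : ∃ k, K i₀ k ∧ k < N := by
    obtain ⟨k, hk⟩ := hne
    refine ⟨k % m, (hK _ _ _ hk).2 ?_, (Nat.mod_lt _ (by omega)).trans_le
      (Nat.le_of_dvd (Nat.factorial_pos m) hmN)⟩
    rw [hi₀]
    exact (Nat.mod_modEq k m).symm
  let Q : Polynomial ℂ :=
    Polynomial.X * ∏ i ∈ B with x i ≠ x i₀, (Polynomial.X - Polynomial.C (x i))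
  have hQd : Q.natDegree < m.minFac := by
    refine lt_of_le_of_lt ?_ hlt
    have hss : (B.filter fun i => x i ≠ x i₀) ⊂ B :=
      Finset.filter_ssubset.2 ⟨i₀, hi₀B, by simp⟩
    have := Finset.card_lt_card hss
    refine (Polynomial.natDegree_mul_le).trans ?_
    rw [Polynomial.natDegree_X, Polynomial.natDegree_prod_of_monic _ _
      fun i _ => Polynomial.monic_X_sub_C _]
    simp only [Polynomial.natDegree_X_sub_C, Finset.sum_const, smul_eq_mul, mul_one]
    omega
  have hQx : Q.eval (x i₀) ≠ 0 := by
    simp only [Q, Polynomial.eval_mul, Polynomial.eval_X, Polynomial.eval_prod,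
      Polynomial.eval_sub, Polynomial.eval_C]
    refine mul_ne_zero ?_ (Finset.prod_ne_zero_iff.2 fun i hi => ?_)
    · rw [← hx i₀ hi₀B k₀ hk₀]
      exact pow_ne_zero _ (hζ.ne_zero hm0)
    · exact sub_ne_zero.2 (Finset.mem_filter.1 hi).2.symm
  have hterm : ∀ i ∈ B, ∀ k, (if K i k then Q.eval (ζ ^ k) else 0) =
      Q.eval (x i₀) * ((if K i k ∧ x i = x i₀ then 1 else 0 : ℕ) : ℂ) := by
    intro i hi k
    by_cases hk : K i k
    · by_cases hxi : x i = x i₀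
      · simp [hk, hx i hi k hk, hxi]
      · have : Q.eval (x i) = 0 := by
          simp only [Q, Polynomial.eval_mul, Polynomial.eval_prod]
          rw [Finset.prod_eq_zero (Finset.mem_filter.2 ⟨hi, hxi⟩) (by simp), mul_zero]
        simp [hk, hx i hi k hk, hxi, this]
    · simp [hk]
  have hsum := hpoly Q (by simp [Q]) hQd
  rw [Finset.sum_congr rfl fun i hi => Finset.sum_congr rfl fun k _ => hterm i hi k] at hsum
  simp only [← Finset.mul_sum, ← Nat.cast_sum] at hsum
  have hzero := Nat.cast_eq_zero.1 ((mul_eq_zero.1 hsum).resolve_left hQx)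
  have := Finset.sum_eq_zero_iff.1 (Finset.sum_eq_zero_iff.1 hzero i₀ hi₀B) k₀
    (Finset.mem_range.2 hk₀N)
  simp [hk₀] at this


/-- If the transition group of `H s` (the subgroup of largest index `d s` in a
coset partition of the free group `F n`) contains a `d s`-cycle (some `w` acts transitively,
i.e. as a single cycle, on the `d s` right cosets of `H s` by right multiplication), then the
index `d s` appears at least `p` times in the partition, where `p` is the smallest prime
dividing `d s`; moreover any two subgroups of the partition with equal indices are isomorphic. -/
theorem herzog_schonheim_of_ds_cycle
    (n s : ℕ) (hn : 2 ≤ n) (hs : 0 < s)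
    (H : Fin s → Subgroup (FreeGroup (Fin n)))
    (α : Fin s → FreeGroup (Fin n))
    (d : Fin s → ℕ)
    (hind : ∀ i, (H i).index = d i)
    (hone : ∀ i, 1 < d i)
    (hmono : Monotone d)
    (hpart : ∀ x : FreeGroup (Fin n), ∃! i : Fin s, x * (α i)⁻¹ ∈ H i)
    (hcycle : ∃ w : FreeGroup (Fin n), ∀ x y : FreeGroup (Fin n),
        ∃ k : ℤ, x * w ^ k * y⁻¹ ∈ H ⟨s - 1, by omega⟩) :
    (d ⟨s - 1, by omega⟩).minFac ≤
      (Finset.univ.filter (fun i => d i = d ⟨s - 1, by omega⟩)).card ∧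
    ∀ i j, d i = d j → Nonempty ((H i) ≃* (H j)) := by
  obtain ⟨w, hw⟩ := hcycle
  set L : Fin s := ⟨s - 1, by omega⟩ with hL
  have hfin : ∀ i, (H i).FiniteIndex := fun i =>
    ⟨by rw [hind]; exact (zero_lt_one.trans (hone i)).ne'⟩
  refine ⟨?_, fun i j hij => Subgroup.nonempty_mulEquiv_of_index_eq (by rw [hind, hind, hij])⟩
  let e : Fin s → ℕ := fun i =>
    Function.minimalPeriod (w • ·) ((1 : FreeGroup (Fin n)) : FreeGroup (Fin n) ⧸ H i)
  have he : ∀ i (k : ℤ), (e i : ℤ) ∣ k ↔ w ^ k ∈ H i := by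
    intro i k
    rw [← MulAction.zpow_smul_eq_iff_minimalPeriod_dvd, MulAction.Quotient.smul_coe,
      QuotientGroup.eq]
    simp
  have hele : ∀ i, 0 < e i ∧ e i ≤ d i := by
    intro i
    obtain ⟨k, hk0, hkle, hk⟩ :=
      Subgroup.exists_pow_mem_of_index_ne_zero (hfin i).index_ne_zero w
    have hdvd : e i ∣ k := Int.natCast_dvd_natCast.1 ((he i k).2 (by simpa using hk))
    exact ⟨Nat.pos_of_dvd_of_pos hdvd hk0, (Nat.le_of_dvd hk0 hdvd).trans (hind i ▸ hkle)⟩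
  have hdle : ∀ i, d i ≤ d L := fun i => hmono (Fin.le_def.2 (by simp [hL]; omega))
  have heL : e L = d L := by
    have htop : MulAction.orbit (Subgroup.zpowers w)
        ((1 : FreeGroup (Fin n)) : FreeGroup (Fin n) ⧸ H L) = Set.univ := by
      refine Set.eq_univ_of_forall fun q => ?_
      obtain ⟨g, rfl⟩ := QuotientGroup.mk_surjective q
      obtain ⟨k, hk⟩ := hw g⁻¹ 1
      refine ⟨⟨w ^ k, zpow_mem (Subgroup.mem_zpowers w) _⟩, ?_⟩
      change w ^ k • ((1 : FreeGroup (Fin n)) : FreeGroup (Fin n) ⧸ H L) = g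
      rw [MulAction.Quotient.smul_coe, QuotientGroup.eq, ← inv_mem_iff]
      simpa using hk
    have := Fintype.ofFinite (MulAction.orbit (Subgroup.zpowers w)
        ((1 : FreeGroup (Fin n)) : FreeGroup (Fin n) ⧸ H L))
    rw [← hind, Subgroup.index, ← Nat.card_univ, ← htop, Nat.card_eq_fintype_card]
    exact @MulAction.minimalPeriod_eq_card _ _ _ w _ _ this
  have hK : ∀ i (k l : ℤ), w ^ k * (α i)⁻¹ ∈ H i →
      (w ^ l * (α i)⁻¹ ∈ H i ↔ (e i : ℤ) ∣ l - k) := by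
    intro i k l hk
    have hmul : w ^ l * (α i)⁻¹ = w ^ (l - k) * (w ^ k * (α i)⁻¹) := by
      rw [← mul_assoc, ← zpow_add, sub_add_cancel]
    rw [he, hmul, Subgroup.mul_mem_cancel_right _ hk]
  obtain ⟨k, hk⟩ := hw 1 (α L)
  rw [one_mul] at hk
  refine (minFac_le_card_of_residue_partition (fun i k => w ^ k * (α i)⁻¹ ∈ H i) e (hone L)
    (fun i => (hele i).1) (fun i => (hele i).2.trans (hdle i)) (fun i k l hk => ?_)
    (fun k => hpart (w ^ k)) heL ⟨(k % e L).toNat, ?_⟩).trans (Finset.card_le_card fun i hi => ?_)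
  · rw [Nat.modEq_iff_dvd]
    simpa using hK i k l (by simpa using hk)
  · have hnonneg : 0 ≤ k % e L := Int.emod_nonneg _ (by exact_mod_cast (hele L).1.ne')
    rw [← zpow_natCast, Int.toNat_of_nonneg hnonneg, hK L k _ hk]
    exact (Int.mod_modEq k (e L)).symm.dvd
  · rw [Finset.mem_filter] at hi ⊢
    exact ⟨hi.1, le_antisymm (hdle i) (hi.2 ▸ (hele i).2)⟩
end

section
/- Let n ≥ 2 and let {H_iα_i}_{i=1}^{s} be a coset partition of the free group F_n, where H_i < F_n has finite index d_i, α_i ∈ F_n, and 1 < d_1 ≤ … ≤ d_s. If there exists w ∈ F_n such that the least positive integer m with w^m ∈ α_s⁻¹H_sα_s equals d_s, then the index d_s appears in the partition at least p times (i.e., |{i : d_i = d_s}| ≥ p), where p is the smallest prime dividing d_s. -/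
open Finset Polynomial

/-- The sum of a function over a full period does not change under translation. -/
theorem sum_range_add_of_periodic {A : Type*} [AddCommGroup A] {g : ℕ → A} {N : ℕ}
    (hg : ∀ k, g (k + N) = g k) (m : ℕ) :
    ∑ k ∈ range N, g (k + m) = ∑ k ∈ range N, g k := by
  induction m with
  | zero => rfl
  | succ m ih =>
    have h1 := sum_range_succ (fun k => g (k + m)) N
    have h2 := sum_range_succ' (fun k => g (k + m)) N
    rw [h1, ih] at h2
    have h3 : g (N + m) = g (0 + m) := by rw [add_comm N m, hg, zero_add]
    rw [h3] at h2
    simpa [add_assoc, add_comm 1 m] using (add_right_cancel h2).symm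

/-- The sum of an `M`-periodic function over `q` periods is `q` times the sum over one period. -/
theorem sum_range_mul_of_periodic {A : Type*} [AddCommGroup A] {g : ℕ → A} {M : ℕ}
    (hg : ∀ k, g (k + M) = g k) (q : ℕ) :
    ∑ k ∈ range (M * q), g k = q • ∑ k ∈ range M, g k := by
  have hq : ∀ q k, g (M * q + k) = g k := by
    intro q k
    induction q with
    | zero => simp
    | succ q ih => rw [mul_add, mul_one, add_right_comm, hg, ih]
  induction q with
  | zero => simp
  | succ q ih => simp only [mul_add, mul_one, sum_range_add, ih, hq, succ_nsmul]

/-- If the sum of `ζ ^ k` over a set of exponents below `M` containing `0` vanishes for every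
primitive `M`-th root of unity `ζ`, the set has at least `M.minFac` elements. -/
theorem minFac_le_card_of_sum_pow_eq_zero {M : ℕ} (hM : M ≠ 0) {T : Finset ℕ}
    (hT : ∀ k ∈ T, k < M) (h0 : 0 ∈ T)
    (hsum : ∀ ζ : ℂ, IsPrimitiveRoot ζ M → ∑ k ∈ T, ζ ^ k = 0) :
    M.minFac ≤ #T := by
  by_contra! hlt
  have hζ := Complex.isPrimitiveRoot_exp M hM
  set ζ := Complex.exp (2 * Real.pi * Complex.I / M)
  let Q : ℂ[X] := X * ∏ k ∈ T.erase 0, (X - C (ζ ^ k))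
  have hdeg : Q.natDegree < M.minFac := by
    refine lt_of_le_of_lt ?_ hlt
    refine natDegree_mul_le.trans ?_
    rw [natDegree_X, natDegree_finsetProd_X_sub_C_eq_card, card_erase_of_mem h0]
    have := card_pos.2 ⟨0, h0⟩
    omega
  have hzero : ∑ k ∈ T, Q.eval (ζ ^ k) = 0 := by
    simp_rw [eval_eq_sum_range]
    rw [sum_comm]
    refine sum_eq_zero fun j hj => ?_
    rw [← mul_sum]
    rcases Nat.eq_zero_or_pos j with rfl | hj0
    · simp [Q]
    · have hcop : j.Coprime M :=
        (Nat.coprime_of_lt_minFac hj0.ne' (by rw [mem_range] at hj; omega)).symm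
      have := hsum _ (hζ.pow_of_coprime j hcop)
      simp_rw [← pow_mul, mul_comm j] at this
      simp_rw [← pow_mul, this, mul_zero]
  rw [← add_sum_erase T _ h0, sum_eq_zero (s := T.erase 0), add_zero] at hzero
  · simp only [Q, eval_mul, eval_X, eval_prod, eval_sub, eval_C, pow_zero, one_mul] at hzero
    obtain ⟨k, hk, hk1⟩ := prod_eq_zero_iff.1 hzero
    rw [mem_erase] at hk
    exact hζ.pow_ne_one_of_pos_of_lt hk.1 (hT k hk.2) (sub_eq_zero.1 hk1).symm
  · intro k hk
    simp only [Q, eval_mul, eval_prod]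
    rw [prod_eq_zero hk (by simp), mul_zero]

/-- In a partition of `ℕ` into finitely many classes, the class `i` being invariant under translation
by `m i ≤ M` and contained in a single residue class modulo `M` if `m i = M`, the modulus `M`
occurs at least `M.minFac` times as soon as it occurs at the class of `0`. -/
theorem minFac_le_card_of_periodic_partition {ι : Type*} [Fintype ι] {M : ℕ} (hM : 1 < M)
    (f : ℕ → ι) (m : ι → ℕ) (hpos : ∀ i, 0 < m i) (hle : ∀ i, m i ≤ M)
    (hper : ∀ i k, f (k + m i) = i ↔ f k = i)
    (hres : ∀ i, m i = M → ∀ j k, f j = i → f k = i → j ≡ k [MOD M])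
    (h0 : m (f 0) = M) :
    M.minFac ≤ #{i | m i = M} := by
  classical
  set N := ∏ i, m i
  have hmul : ∀ i q k, f (k + m i * q) = i ↔ f k = i := by
    intro i q k
    induction q with
    | zero => simp
    | succ q ih => rw [mul_add, mul_one, ← add_assoc, hper, ih]
  have hdvd : ∀ i, m i ∣ N := fun i => dvd_prod_of_mem m (mem_univ i)
  have hfN : ∀ k, f (k + N) = f k := by
    intro k
    obtain ⟨q, hq⟩ := hdvd (f k)
    rw [hq, hmul]
  have hfM : ∀ k, m (f (k + M)) = M ↔ m (f k) = M := by
    refine fun k => ⟨fun h => ?_, fun h => ?_⟩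
    · have := (hper (f (k + M)) k).1 (by rw [h])
      rwa [this]
    · have := (hper (f k) k).2 rfl
      rw [h] at this
      rwa [this]
  obtain ⟨q, hq⟩ : M ∣ N := h0 ▸ hdvd (f 0)
  have hq0 : q ≠ 0 := by
    rintro rfl
    exact (prod_pos fun i _ => hpos i).ne' hq
  let T := (range M).filter fun k => m (f k) = M
  have hcard : #T ≤ #{i | m i = M} := by
    refine card_le_card_of_injOn f (fun k hk => ?_) fun j hj k hk hjk => ?_
    · simpa using (mem_filter.1 hk).2
    · have hj := mem_filter.1 hj
      have hk := mem_filter.1 hk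
      exact (hres _ hk.2 j k hjk rfl).eq_of_lt_of_lt (mem_range.1 hj.1) (mem_range.1 hk.1)
  refine (minFac_le_card_of_sum_pow_eq_zero (by omega) (T := T)
    (fun k hk => mem_range.1 (mem_filter.1 hk).1)
    (mem_filter.2 ⟨mem_range.2 (by omega), h0⟩) fun ζ hζ => ?_).trans hcard
  have hζN : ζ ^ N = 1 := by rw [hq, pow_mul, hζ.pow_eq_one, one_pow]
  have hclass : ∀ i, m i ≠ M → ∑ k ∈ range N, (if f k = i then ζ ^ k else 0) = 0 := by
    intro i hi
    have h := sum_range_add_of_periodic (N := N) (g := fun k => if f k = i then ζ ^ k else 0)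
      (fun k => by simp only [hfN, pow_add, hζN, mul_one]) (m i)
    simp only [hper, pow_add, ← ite_zero_mul, ← sum_mul] at h
    have hne := hζ.pow_ne_one_of_pos_of_lt (hpos i).ne' (lt_of_le_of_ne (hle i) hi)
    by_contra hS
    exact hne (mul_left_cancel₀ hS (by rw [h, mul_one]))
  have htot : ∑ k ∈ range N, (if m (f k) = M then ζ ^ k else 0) = 0 := by
    have hgeom : ∑ k ∈ range N, ζ ^ k = 0 := by
      have := geom_sum_mul ζ N
      rw [hζN, sub_self] at this
      exact (mul_eq_zero.1 this).resolve_right (sub_ne_zero.2 (hζ.ne_one hM))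
    have hrest : ∑ k ∈ range N, (if m (f k) = M then 0 else ζ ^ k) = 0 := by
      have : ∀ k, (if m (f k) = M then 0 else ζ ^ k) =
          ∑ i with m i ≠ M, if f k = i then ζ ^ k else 0 := by
        intro k
        rw [sum_ite_eq]
        simp [ite_not]
      simp_rw [this]
      rw [sum_comm]
      exact sum_eq_zero fun i hi => hclass i (mem_filter.1 hi).2
    rw [← sub_zero (∑ k ∈ range N, ζ ^ k), ← hrest, ← sum_sub_distrib] at hgeom
    rw [hrest] at hgeom
    refine (sum_congr rfl fun k _ => ?_).trans hgeom
    split_ifs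
    · rw [sub_zero]
    · rw [sub_self]
  rw [hq, sum_range_mul_of_periodic
    (fun k => by simp only [hfM, pow_add, hζ.pow_eq_one, mul_one])] at htot
  rw [sum_filter]
  simpa [hq0] using htot

/-- If some `w ∈ F n` has order `d s` at the coset `H s • α s` (the least positive
`m` with `w ^ m ∈ (α s)⁻¹ * H s * α s` equals `d s`), then the index `d s` appears in the coset
partition at least `p` times, where `p` is the smallest prime dividing `d s`. -/
theorem ds_appears_minFac_times_of_order_eq_ds
    (n s : ℕ) (hn : 2 ≤ n) (hs : 0 < s)
    (H : Fin s → Subgroup (FreeGroup (Fin n)))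
    (α : Fin s → FreeGroup (Fin n))
    (d : Fin s → ℕ)
    (hind : ∀ i, (H i).index = d i)
    (hone : ∀ i, 1 < d i)
    (hmono : Monotone d)
    (hpart : ∀ x : FreeGroup (Fin n), ∃! i : Fin s, x * (α i)⁻¹ ∈ H i)
    (hw : ∃ w : FreeGroup (Fin n),
        IsLeast {m : ℕ | 0 < m ∧
          α ⟨s - 1, by omega⟩ * w ^ m * (α ⟨s - 1, by omega⟩)⁻¹ ∈ H ⟨s - 1, by omega⟩}
          (d ⟨s - 1, by omega⟩)) :
    (d ⟨s - 1, by omega⟩).minFac ≤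
      (Finset.univ.filter (fun i => d i = d ⟨s - 1, by omega⟩)).card := by
  obtain ⟨w, -, hMmin⟩ := hw
  generalize hl : (⟨s - 1, by omega⟩ : Fin s) = l at *
  have hdl : ∀ i, d i ≤ d l := fun i => hmono (by rw [← hl, Fin.le_def]; simp; omega)
  choose f hf hfu using fun k : ℕ => hpart (α l * w ^ k)
  have hiff : ∀ i k, f k = i ↔ α l * w ^ k * (α i)⁻¹ ∈ H i :=
    fun i k => ⟨fun h => h ▸ hf k, fun h => (hfu k i h).symm⟩
  have hconj : ∀ i k, (α i * w * (α i)⁻¹) ^ k = α i * w ^ k * (α i)⁻¹ := fun i k => conj_pow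
  have hex : ∀ i, ∃ m, 0 < m ∧ m ≤ d i ∧ α i * w ^ m * (α i)⁻¹ ∈ H i := by
    intro i
    obtain ⟨m, hm0, hm, hmem⟩ := (H i).exists_pow_mem_of_index_ne_zero
      (by have := hone i; rw [hind]; omega) (α i * w * (α i)⁻¹)
    exact ⟨m, hm0, hind i ▸ hm, hconj i m ▸ hmem⟩
  classical
  let m : Fin s → ℕ := fun i => Nat.find (hex i)
  have hm : ∀ i, 0 < m i ∧ m i ≤ d i ∧ α i * w ^ m i * (α i)⁻¹ ∈ H i :=
    fun i => Nat.find_spec (hex i)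
  have hmmin : ∀ i k, 0 < k → α i * w ^ k * (α i)⁻¹ ∈ H i → m i ≤ k := by
    intro i k hk hmem
    rcases le_or_gt k (d i) with h | h
    · exact Nat.find_min' (hex i) ⟨hk, h, hmem⟩
    · exact (hm i).2.1.trans h.le
  have hsplit : ∀ i j k, α l * w ^ (j + k) * (α i)⁻¹ =
      α l * w ^ j * (α i)⁻¹ * (α i * w ^ k * (α i)⁻¹) := by
    intro i j k
    rw [pow_add]
    group
  have hml : m l = d l := le_antisymm (hm l).2.1 (hMmin ⟨(hm l).1, (hm l).2.2⟩)
  have hres : ∀ i j k, j ≤ k → f j = i → f k = i → m i ∣ k - j := by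
    intro i j k hjk hj hk
    obtain ⟨t, rfl⟩ := Nat.exists_eq_add_of_le hjk
    rw [hiff] at hj hk
    rw [hsplit, (H i).mul_mem_cancel_left hj, ← hconj, ← Nat.div_add_mod t (m i), pow_add, pow_mul,
      (H i).mul_mem_cancel_left ((H i).pow_mem (by rw [hconj]; exact (hm i).2.2) _), hconj] at hk
    rw [Nat.add_sub_cancel_left]
    refine Nat.dvd_of_mod_eq_zero (Nat.eq_zero_of_not_pos fun hpos => ?_)
    exact (Nat.mod_lt t (hm i).1).not_ge (hmmin i _ hpos hk)
  have hf0 : f 0 = l := (hiff l 0).2 (by simp)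
  refine (minFac_le_card_of_periodic_partition (hone l) f m (fun i => (hm i).1)
    (fun i => (hm i).2.1.trans (hdl i)) (fun i k => ?_) (fun i hi j k hj hk => ?_)
    (by rw [hf0, hml])).trans (Finset.card_le_card fun i hi => ?_)
  · rw [hiff, hiff, hsplit, (H i).mul_mem_cancel_right (hm i).2.2]
  · rw [← hi]
    rcases le_total j k with h | h
    · exact (Nat.modEq_iff_dvd' h).2 (hres i j k h hj hk)
    · exact ((Nat.modEq_iff_dvd' h).2 (hres i k j h hk hj)).symm
  · simp only [Finset.mem_filter, Finset.mem_univ, true_and] at hi ⊢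
    exact le_antisymm (hdl i) (hi ▸ (hm i).2.1)
end
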